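/- arXiv:1801.04955 — 3 statements merged into one kernel-verified Lean document; each statement's English description precedes it below -/
import Mathlib

section
/- Let k be a nonarchimedean local field of residual characteristic p and let N be a positive integer divisible by p. Then the multiplicative group k^× = k − {0}, with its topology induced from k, possesses at least two distinct open subgroups U such that the quotient group k^×/U is isomorphic to ℤ/Nℤ. (Claim established in the proof of Lemma 2.2(1).) -/
/-- A nonarchimedean local field structure on a field `K`, encoded by a discrete additive
valuation `val : K → ℝ ∪ {∞}` whose value group is `ℤ`, together with completeness and
a finite residue field of characteristic `p`. -/
structure IsNonarchLocalField {K : Type*} [Field K] (val : K → WithTop ℝ) (p : ℕ) : Prop where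
  val_eq_top_iff : ∀ x : K, val x = ⊤ ↔ x = 0
  val_mul : ∀ x y : K, val (x * y) = val x + val y
  val_add : ∀ x y : K, min (val x) (val y) ≤ val (x + y)
  val_int : ∀ x : K, x ≠ 0 → ∃ n : ℤ, val x = ((n : ℝ) : WithTop ℝ)
  val_surj : ∀ n : ℤ, ∃ x : K, val x = ((n : ℝ) : WithTop ℝ)
  complete : ∀ f : ℕ → K,
    (∀ M : ℝ, ∃ N : ℕ, ∀ m ≥ N, ∀ n ≥ N, (M : WithTop ℝ) ≤ val (f m - f n)) →
    ∃ L : K, ∀ M : ℝ, ∃ N : ℕ, ∀ n ≥ N, (M : WithTop ℝ) ≤ val (f n - L)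
  residue_char : 0 < val (p : K)
  residue_finite : ∃ S : Finset K, ∀ x : K, 0 ≤ val x → ∃ y ∈ S, 0 < val (x - y)

namespace IsNonarchLocalField

variable {K : Type*} [Field K] {val : K → WithTop ℝ} {p : ℕ}

lemma val_one (hk : IsNonarchLocalField val p) : val 1 = 0 := by
  obtain ⟨n, hn⟩ := hk.val_int 1 one_ne_zero
  have h := hk.val_mul 1 1
  rw [mul_one, hn] at h
  rw [hn]
  norm_cast at h ⊢
  omega

lemma exists_val_eq (hk : IsNonarchLocalField val p) :
    ∃ v : Kˣ →* Multiplicative ℤ, ∀ u : Kˣ, val u = (((v u).toAdd : ℝ) : WithTop ℝ) := by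
  choose v hv using fun u : Kˣ => hk.val_int u u.ne_zero
  refine ⟨MonoidHom.mk' (fun u => Multiplicative.ofAdd (v u)) fun a b => ?_, fun u => hv u⟩
  have h := hk.val_mul a b
  rw [← Units.val_mul, hv, hv, hv] at h
  rw [← ofAdd_add]
  congr 1
  exact_mod_cast h

lemma val_neg (hk : IsNonarchLocalField val p) (x : K) : val (-x) = val x := by
  obtain ⟨n, hn⟩ := hk.val_int (-1) (by simp)
  have h := hk.val_mul (-1) (-1)
  rw [neg_mul_neg, mul_one, hk.val_one, hn] at h
  have h0 : val (-1) = 0 := by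
    rw [hn]
    norm_cast at h ⊢
    omega
  rw [← neg_one_mul, hk.val_mul, h0, zero_add]

lemma le_val_add (hk : IsNonarchLocalField val p) {x y : K} {c : WithTop ℝ}
    (hx : c ≤ val x) (hy : c ≤ val y) : c ≤ val (x + y) :=
  (le_min hx hy).trans (hk.val_add x y)

lemma le_val_sub (hk : IsNonarchLocalField val p) {x y : K} {c : WithTop ℝ}
    (hx : c ≤ val x) (hy : c ≤ val y) : c ≤ val (x - y) := by
  rw [sub_eq_add_neg]
  exact hk.le_val_add hx (by rwa [hk.val_neg])

lemma one_le_val (hk : IsNonarchLocalField val p) {x : K} (hx : 0 < val x) : 1 ≤ val x := by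
  rcases eq_or_ne x 0 with rfl | h
  · rw [(hk.val_eq_top_iff 0).2 rfl]
    exact le_top
  · obtain ⟨n, hn⟩ := hk.val_int x h
    rw [hn] at hx ⊢
    norm_cast at hx ⊢

/-- The valuation ring. -/
def integers (hk : IsNonarchLocalField val p) : Subring K where
  carrier := {x | 0 ≤ val x}
  mul_mem' {a b} ha hb := by
    change 0 ≤ val (a * b)
    rw [hk.val_mul]
    exact add_nonneg ha hb
  one_mem' := hk.val_one.ge
  add_mem' ha hb := hk.le_val_add ha hb
  zero_mem' := by
    change 0 ≤ val 0
    rw [(hk.val_eq_top_iff 0).2 rfl]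
    exact le_top
  neg_mem' {a} ha := by
    change 0 ≤ val (-a)
    rwa [hk.val_neg]

lemma val_eq_zero_of_one_le (hk : IsNonarchLocalField val p) {x : K} (hx : 1 ≤ val (x - 1)) :
    val x = 0 := by
  have h01 : (0 : WithTop ℝ) < 1 := zero_lt_one
  refine le_antisymm ?_ ?_
  · by_contra! h
    have h1 := hk.le_val_sub (hk.one_le_val h) hx
    rw [sub_sub_cancel, hk.val_one] at h1
    exact absurd h1 h01.not_ge
  · have := hk.le_val_add (h01.le.trans hx) hk.val_one.ge
    rwa [sub_add_cancel] at this

/-- The second higher unit group `1 + 𝒫 ^ 2`. -/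
def unitsTwo (hk : IsNonarchLocalField val p) : Subgroup Kˣ where
  carrier := {u | 2 ≤ val ((u : K) - 1)}
  mul_mem' {a b} ha hb := by
    have h1 : (1 : WithTop ℝ) ≤ 2 := one_le_two
    change 2 ≤ val (((a * b : Kˣ) : K) - 1)
    have h : ((a * b : Kˣ) : K) - 1 = a * (b - 1) + (a - 1) := by push_cast; ring
    rw [h]
    refine hk.le_val_add ?_ ha
    rw [hk.val_mul, hk.val_eq_zero_of_one_le (h1.trans ha), zero_add]
    exact hb
  one_mem' := by
    change 2 ≤ val (((1 : Kˣ) : K) - 1)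
    rw [Units.val_one, sub_self, (hk.val_eq_top_iff 0).2 rfl]
    exact le_top
  inv_mem' {a} ha := by
    have h1 : (1 : WithTop ℝ) ≤ 2 := one_le_two
    have h0 := hk.val_eq_zero_of_one_le (h1.trans ha)
    change 2 ≤ val (((a⁻¹ : Kˣ) : K) - 1)
    have h : (a : K) * (((a⁻¹ : Kˣ) : K) - 1) = -(a - 1) := by
      rw [mul_sub, Units.mul_inv]; ring
    have h2 := hk.val_mul a (((a⁻¹ : Kˣ) : K) - 1)
    rw [h, h0, zero_add, hk.val_neg] at h2
    rw [← h2]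
    exact ha

lemma val_pow (hk : IsNonarchLocalField val p) (x : K) (n : ℕ) : val (x ^ n) = n • val x := by
  induction n with
  | zero => simpa using hk.val_one
  | succ n ih => rw [pow_succ, hk.val_mul, ih, succ_nsmul]

/-- A `p`-th power of a unit which is congruent to `1` modulo `𝒫` is so modulo `𝒫 ^ 2`. -/
lemma two_le_val_pow_sub_one (hk : IsNonarchLocalField val p) (hp : p.Prime) {w : K}
    (hw : val w = 0) (hwp : 1 ≤ val (w ^ p - 1)) : 2 ≤ val (w ^ p - 1) := by
  have ht : w - 1 ∈ hk.integers := hk.integers.sub_mem hw.ge hk.integers.one_mem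
  obtain ⟨r, hr⟩ := exists_add_pow_prime_eq hp (⟨w - 1, ht⟩ : hk.integers) 1
  replace hr := congrArg (fun x : hk.integers => (x : K)) hr
  push_cast at hr
  have hpow : w ^ p - 1 = (w - 1) ^ p + p * (w - 1) * r := by
    rw [sub_add_cancel] at hr
    rw [hr]
    ring
  have hr0 : 0 ≤ val (r : K) := r.2
  have hp1 := hk.one_le_val hk.residue_char
  have ht0 : 0 ≤ val (w - 1) := ht
  have h1 : 1 ≤ val (p * (w - 1) * r) := by
    rw [hk.val_mul, hk.val_mul]
    exact le_add_of_le_of_nonneg (le_add_of_le_of_nonneg hp1 ht0) hr0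
  have h2 : 1 ≤ val ((w - 1) ^ p) := by
    have := hk.le_val_sub hwp h1
    rwa [hpow, add_sub_cancel_right] at this
  have ht1 : 1 ≤ val (w - 1) := by
    refine hk.one_le_val (ht0.lt_of_ne fun h => ?_)
    rw [hk.val_pow, ← h, smul_zero] at h2
    exact absurd h2 (zero_lt_one (α := WithTop ℝ)).not_ge
  rw [hpow]
  refine hk.le_val_add ?_ ?_
  · rw [← Nat.sub_add_cancel hp.two_le, pow_add, hk.val_mul, hk.val_pow, pow_two, hk.val_mul,
      ← one_add_one_eq_two]
    exact le_add_of_nonneg_of_le (nsmul_nonneg ht0 _) (add_le_add ht1 ht1)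
  · rw [hk.val_mul, hk.val_mul, ← one_add_one_eq_two]
    exact le_add_of_le_of_nonneg (add_le_add hp1 ht1) hr0

/-- If `π` is a uniformizer, then `1 + π` is not a product of a power of `π`, an element of
`1 + 𝒫 ^ 2` and a `p`-th power. -/
lemma one_add_uniformizer_notMem (hk : IsNonarchLocalField val p) (hp : p.Prime) {π u : Kˣ}
    (hπ : val π = 1) (hu : (u : K) = 1 + π) :
    u ∉ Subgroup.zpowers π ⊔ hk.unitsTwo ⊔ (powMonoidHom p : Kˣ →* Kˣ).range := by
  intro hmem
  obtain ⟨v, hv⟩ := hk.exists_val_eq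
  have eq_one {x : Kˣ} (hx : val x = 0) : v x = 1 := by
    rw [hv] at hx
    apply Multiplicative.toAdd.injective
    exact_mod_cast hx
  obtain ⟨y, hy, z, ⟨w, rfl⟩, rfl⟩ := Subgroup.mem_sup.1 hmem
  obtain ⟨x, ⟨m, rfl⟩, s, hs, rfl⟩ := Subgroup.mem_sup.1 hy
  rw [powMonoidHom_apply] at hu
  have h12 : (1 : WithTop ℝ) ≤ 2 := one_le_two
  have hvs := eq_one (hk.val_eq_zero_of_one_le (h12.trans hs))
  have hvu : v (π ^ m * s * w ^ p) = 1 := by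
    refine eq_one (hk.val_eq_zero_of_one_le ?_)
    rw [hu, add_sub_cancel_left, hπ]
  have hvπ : v π = Multiplicative.ofAdd 1 := by
    rw [hv] at hπ
    apply Multiplicative.toAdd.injective
    exact_mod_cast hπ
  have hm : m + p * (v w).toAdd = 0 := by
    have := congrArg Multiplicative.toAdd hvu
    simpa [hvs, hvπ] using this
  set w' : Kˣ := w * π ^ (-(v w).toAdd) with hw'
  have hww : π ^ m * s * w ^ p = s * w' ^ p := by
    rw [hw', mul_pow, ← zpow_natCast (π ^ _), ← zpow_mul, mul_comm (π ^ m) s, mul_assoc,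
      mul_comm (π ^ m)]
    congr 3
    linarith
  have hw0 : val (w' : K) = 0 := by
    rw [hv, hw']
    simp [hvπ]
  rw [hww] at hu
  push_cast at hu
  have hwp0 : val ((w' : K) ^ p) = 0 := by rw [hk.val_pow, hw0, smul_zero]
  have hs' : 2 ≤ val ((w' : K) ^ p * (s - 1)) := by
    rw [hk.val_mul, hwp0, zero_add]
    exact hs
  have heq : (w' : K) ^ p - 1 = π - (w' : K) ^ p * (s - 1) := by
    linear_combination hu
  have h1 : 1 ≤ val ((w' : K) ^ p - 1) := by
    rw [heq]
    exact hk.le_val_sub hπ.ge (h12.trans hs')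
  have h2 := hk.le_val_add (hk.two_le_val_pow_sub_one hp hw0 h1) hs'
  rw [heq, sub_add_cancel, hπ] at h2
  have h12' : (1 : WithTop ℝ) < 2 := by exact_mod_cast (one_lt_two : (1 : ℝ) < 2)
  exact absurd h2 h12'.not_ge

end IsNonarchLocalField

/-- Linear forms separate the points of a vector space. -/
lemma exists_addMonoidHom_field_ne_zero {F V : Type*} [Field F] [AddCommGroup V] [Module F V]
    {x : V} (hx : x ≠ 0) : ∃ f : V →+ F, f x ≠ 0 := by
  obtain ⟨f, hf⟩ := Module.Projective.exists_dual_ne_zero F hx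
  exact ⟨LinearMap.toAddMonoidHom f, hf⟩

/-- Homomorphisms to `ZMod p` separate the points of an additive group of exponent `p`. -/
lemma exists_addMonoidHom_zmod_ne_zero {V : Type*} [AddCommGroup V] {p : ℕ} [Fact p.Prime]
    (hV : ∀ x : V, p • x = 0) {x : V} (hx : x ≠ 0) : ∃ f : V →+ ZMod p, f x ≠ 0 := by
  let _ : Module (ZMod p) V := AddCommGroup.zmodModule hV
  exact exists_addMonoidHom_field_ne_zero hx

/-- Characters of exponent `p` separate the elements outside a subgroup containing all
`p`-th powers from that subgroup. -/
lemma exists_monoidHom_zmod_ne_one {G : Type*} [CommGroup G] {p : ℕ} [Fact p.Prime]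
    {H : Subgroup G} (hH : (powMonoidHom p : G →* G).range ≤ H) {g : G} (hg : g ∉ H) :
    ∃ χ : G →* Multiplicative (ZMod p), (∀ h ∈ H, χ h = 1) ∧ χ g ≠ 1 := by
  have hexp : ∀ x : Additive (G ⧸ H), p • x = 0 := by
    intro x
    obtain ⟨y, hy⟩ := QuotientGroup.mk_surjective x.toMul
    apply Additive.toMul.injective
    rw [toMul_nsmul, ← hy, ← QuotientGroup.mk_pow, toMul_zero, QuotientGroup.eq_one_iff]
    exact hH ⟨y, rfl⟩
  have hne : Additive.ofMul (QuotientGroup.mk' H g) ≠ 0 := by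
    rwa [Ne, ofMul_eq_zero, QuotientGroup.mk'_apply, QuotientGroup.eq_one_iff]
  obtain ⟨f, hf⟩ := exists_addMonoidHom_zmod_ne_zero hexp hne
  refine ⟨(AddMonoidHom.toMultiplicativeRight f).comp (QuotientGroup.mk' H),
    fun h hh => ?_, fun h => hf ?_⟩
  · have : QuotientGroup.mk' H h = 1 := (QuotientGroup.eq_one_iff h).2 hh
    rw [MonoidHom.comp_apply, this, map_one]
  · exact congrArg Multiplicative.toAdd h

/-- The cyclic group of order `N` contains that of order `p` when `p ∣ N`. -/
lemma exists_zmod_addMonoidHom_injective {p N : ℕ} (hN : 0 < N) (hpN : p ∣ N) :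
    ∃ j : ZMod p →+ ZMod N, Function.Injective j := by
  obtain ⟨d, rfl⟩ := hpN
  have hd : d ≠ 0 := by rintro rfl; simp at hN
  have h0 : (zmultiplesHom (ZMod (p * d)) (d : ZMod (p * d))) (p : ℤ) = 0 := by
    simp [← Nat.cast_mul]
  refine ⟨ZMod.lift p ⟨_, h0⟩, (ZMod.lift_injective _).2 fun m hm => ?_⟩
  rw [ZMod.intCast_zmod_eq_zero_iff_dvd]
  have hm' : ((m * d : ℤ) : ZMod (p * d)) = 0 := by simpa using hm
  rw [ZMod.intCast_zmod_eq_zero_iff_dvd, Nat.cast_mul] at hm'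
  exact Int.dvd_of_mul_dvd_mul_right (by exact_mod_cast hd) hm'

lemma IsNonarchLocalField.isOpen_image_of_unitsTwo_le {k : Type*} [Field k] [TopologicalSpace k]
    {val : k → WithTop ℝ} {p : ℕ} (hk : IsNonarchLocalField val p)
    (htopology : ∀ s : Set k, IsOpen s ↔
      ∀ x ∈ s, ∃ M : ℝ, {y : k | (M : WithTop ℝ) ≤ val (y - x)} ⊆ s)
    {U : Subgroup kˣ} (hU : hk.unitsTwo ≤ U) :
    IsOpen ((fun u : kˣ => (u : k)) '' (U : Set kˣ)) := by
  rw [htopology]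
  rintro _ ⟨x, hx, rfl⟩
  obtain ⟨n, hn⟩ := hk.val_int x x.ne_zero
  refine ⟨n + 2, fun y hy => ?_⟩
  have hz : 2 ≤ val (y / x - 1) := by
    have h : (y : k) - x = x * (y / x - 1) := by
      field_simp [x.ne_zero]
    rw [Set.mem_ofPred_eq, h, hk.val_mul, hn, WithTop.coe_add] at hy
    exact (WithTop.add_le_add_iff_left WithTop.coe_ne_top).1 hy
  have h0 := hk.val_eq_zero_of_one_le ((one_le_two (α := WithTop ℝ)).trans hz)
  have hne : y / x ≠ 0 := by
    intro h
    rw [(hk.val_eq_top_iff _).2 h] at h0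
    exact WithTop.top_ne_zero h0
  refine ⟨x * Units.mk0 _ hne, U.mul_mem hx (hU hz), ?_⟩
  simp [mul_div_cancel₀]

/-- **Claim from the proof of Lemma 2.2(1)**: if `k` is a nonarchimedean local field of
residual characteristic `p` and `N` is a positive integer divisible by `p`, then `k^×`
has at least two distinct open subgroups `U` (open for the topology induced from `k`, which
is the valuation topology) with `k^×/U ≅ ℤ/Nℤ`.  The isomorphism `k^×/U ≅ ℤ/Nℤ` is
expressed by the existence of a surjective homomorphism `k^× →* ℤ/Nℤ` with kernel `U`. -/
theorem exists_two_open_subgroups_with_cyclic_quotient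
    {k : Type*} [Field k] [TopologicalSpace k]
    (p : ℕ) (hp : p.Prime) (val : k → WithTop ℝ)
    (hk : IsNonarchLocalField val p)
    (htopology : ∀ s : Set k, IsOpen s ↔
      ∀ x ∈ s, ∃ M : ℝ, {y : k | (M : WithTop ℝ) ≤ val (y - x)} ⊆ s)
    (N : ℕ) (hN : 0 < N) (hpN : p ∣ N) :
    ∃ U₁ U₂ : Subgroup kˣ, U₁ ≠ U₂ ∧
      IsOpen ((fun u : kˣ => (u : k)) '' (U₁ : Set kˣ)) ∧
      IsOpen ((fun u : kˣ => (u : k)) '' (U₂ : Set kˣ)) ∧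
      (∃ φ : kˣ →* Multiplicative (ZMod N), Function.Surjective φ ∧ φ.ker = U₁) ∧
      (∃ φ : kˣ →* Multiplicative (ZMod N), Function.Surjective φ ∧ φ.ker = U₂) := by
  have : Fact p.Prime := ⟨hp⟩
  obtain ⟨v, hv⟩ := hk.exists_val_eq
  obtain ⟨ϖ, hϖ⟩ := hk.val_surj 1
  replace hϖ : val ϖ = 1 := by simpa using hϖ
  have hϖ0 : ϖ ≠ 0 := by
    intro h
    rw [(hk.val_eq_top_iff _).2 h] at hϖ
    exact WithTop.top_ne_one hϖ
  set π : kˣ := Units.mk0 ϖ hϖ0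
  have hπ : val (π : k) = 1 := hϖ
  have eq_one {x : kˣ} (hx : 1 ≤ val ((x : k) - 1)) : v x = 1 := by
    have h := hk.val_eq_zero_of_one_le hx
    rw [hv] at h
    apply Multiplicative.toAdd.injective
    exact_mod_cast h
  have hvπ : v π = Multiplicative.ofAdd 1 := by
    rw [hv] at hπ
    apply Multiplicative.toAdd.injective
    exact_mod_cast hπ
  have hu1 : 1 ≤ val ((1 + ϖ) - 1) := by rw [add_sub_cancel_left, hϖ]
  have hu0 : 1 + ϖ ≠ 0 := by
    intro h
    have h0 := hk.val_eq_zero_of_one_le hu1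
    rw [(hk.val_eq_top_iff _).2 h] at h0
    exact WithTop.top_ne_zero h0
  set u : kˣ := Units.mk0 (1 + ϖ) hu0
  obtain ⟨χ, hχ, hχu⟩ := exists_monoidHom_zmod_ne_one le_sup_right
    (hk.one_add_uniformizer_notMem hp (u := u) hπ rfl)
  have hχπ : χ π = 1 :=
    hχ _ (Subgroup.mem_sup_left (Subgroup.mem_sup_left (Subgroup.mem_zpowers π)))
  have hχ2 {x : kˣ} (hx : x ∈ hk.unitsTwo) : χ x = 1 :=
    hχ _ (Subgroup.mem_sup_left (Subgroup.mem_sup_right hx))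
  have hv2 {x : kˣ} (hx : x ∈ hk.unitsTwo) : v x = 1 :=
    eq_one ((one_le_two (α := WithTop ℝ)).trans hx)
  obtain ⟨j, hj⟩ := exists_zmod_addMonoidHom_injective hN hpN
  let φ₁ : kˣ →* Multiplicative (ZMod N) :=
    (AddMonoidHom.toMultiplicative (Int.castAddHom (ZMod N))).comp v
  let ψ : kˣ →* Multiplicative (ZMod N) := (AddMonoidHom.toMultiplicative j).comp χ
  have hφ₁ {x : kˣ} (hx : v x = 1) : φ₁ x = 1 := by
    rw [MonoidHom.comp_apply, hx, map_one]
  have hψ {x : kˣ} (hx : χ x = 1) : ψ x = 1 := by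
    rw [MonoidHom.comp_apply, hx, map_one]
  have hφ₁π : φ₁ π = Multiplicative.ofAdd 1 := by
    simp [φ₁, hvπ]
  have hsurj {φ : kˣ →* Multiplicative (ZMod N)} (h : φ π = Multiplicative.ofAdd 1) :
      Function.Surjective φ := by
    intro y
    obtain ⟨n, hn⟩ := ZMod.intCast_surjective y.toAdd
    refine ⟨π ^ n, ?_⟩
    rw [map_zpow, h, ← ofAdd_zsmul, zsmul_one, hn, ofAdd_toAdd]
  refine ⟨φ₁.ker, (φ₁ * ψ).ker, fun h => hχu ?_,
    hk.isOpen_image_of_unitsTwo_le htopology fun x hx => hφ₁ (hv2 hx),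
    hk.isOpen_image_of_unitsTwo_le htopology fun x hx => ?_,
    ⟨φ₁, hsurj hφ₁π, rfl⟩, ⟨φ₁ * ψ, hsurj ?_, rfl⟩⟩
  · have h1 : φ₁ u = 1 := hφ₁ (eq_one hu1)
    have h2 : u ∈ (φ₁ * ψ).ker := h ▸ h1
    rw [MonoidHom.mem_ker, MonoidHom.mul_apply, h1, one_mul] at h2
    apply Multiplicative.toAdd.injective
    apply hj
    rw [toAdd_one, map_zero]
    exact congrArg Multiplicative.toAdd h2
  · rw [MonoidHom.mem_ker, MonoidHom.mul_apply, hφ₁ (hv2 hx), hψ (hχ2 hx), one_mul]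
  · rw [MonoidHom.mul_apply, hφ₁π, hψ hχπ, mul_one]
end

section
/- Let k be a nonarchimedean local field of residual characteristic p, with fixed separable closure k^s, and let F ⊆ k^s be a finite Galois extension of k whose Galois group Gal(F/k) is isomorphic to one of the following groups: the trivial group, ℤ/2ℤ, ℤ/3ℤ, or the symmetric group S₃. Then there exists a Galois extension E ⊆ k^s of k of degree 2 such that E ∩ F = k, and consequently the restriction map Gal(EF/k) → Gal(E/k) × Gal(F/k) is an isomorphism, where EF denotes the composite field. (Lemma 2.2(2).) -/
/-- `σ ∈ Gal(EF/k)` restricts to `τ₁ ∈ Gal(E/k)` on `E` and to `τ₂ ∈ Gal(F/k)` on `F`. -/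
def RestrictsTo {k K : Type*} [Field k] [Field K] [Algebra k K]
    (E F : IntermediateField k K)
    (σ : ↥(E ⊔ F) ≃ₐ[k] ↥(E ⊔ F))
    (τ : (↥E ≃ₐ[k] ↥E) × (↥F ≃ₐ[k] ↥F)) : Prop :=
  (∀ (x : K) (hx : x ∈ E),
      ((σ ⟨x, (le_sup_left : E ≤ E ⊔ F) hx⟩ : ↥(E ⊔ F)) : K) = ((τ.1 ⟨x, hx⟩ : ↥E) : K)) ∧
  (∀ (x : K) (hx : x ∈ F),
      ((σ ⟨x, (le_sup_right : F ≤ E ⊔ F) hx⟩ : ↥(E ⊔ F)) : K) = ((τ.2 ⟨x, hx⟩ : ↥F) : K))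

section LocalFieldQuadratic

open Polynomial IntermediateField

/-- A normalized discrete valuation with finite residue field yields an integer-valued function
on the nonzero elements with the usual properties. -/
theorem IsNonarchLocalField.exists_int_valuation {k : Type*} [Field k] {val : k → WithTop ℝ}
    {p : ℕ} (hk : IsNonarchLocalField val p) :
    ∃ v : k → ℤ, (∀ x y, x ≠ 0 → y ≠ 0 → v (x * y) = v x + v y) ∧
      (∀ x y, x ≠ 0 → y ≠ 0 → x + y ≠ 0 → min (v x) (v y) ≤ v (x + y)) ∧
      (∀ n, ∃ x, x ≠ 0 ∧ v x = n) ∧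
      ∃ S : Finset k, ∀ x, x ≠ 0 → 0 ≤ v x → ∃ y ∈ S, x = y ∨ 0 < v (x - y) := by
  choose! v hv using hk.val_int
  refine ⟨v, fun x y hx hy => ?_, fun x y hx hy hxy => ?_, fun n => ?_, ?_⟩
  · have h := hk.val_mul x y
    rw [hv x hx, hv y hy, hv _ (mul_ne_zero hx hy)] at h
    exact_mod_cast h
  · have h := hk.val_add x y
    rw [hv x hx, hv y hy, hv _ hxy] at h
    exact_mod_cast h
  · obtain ⟨x, hx⟩ := hk.val_surj n
    have hx0 : x ≠ 0 := by
      rintro rfl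
      rw [(hk.val_eq_top_iff 0).2 rfl] at hx
      exact WithTop.top_ne_coe hx
    refine ⟨x, hx0, ?_⟩
    rw [hv x hx0] at hx
    exact_mod_cast hx
  · obtain ⟨S, hS⟩ := hk.residue_finite
    refine ⟨S, fun x hx h => ?_⟩
    obtain ⟨y, hy, hxy⟩ := hS x (by rw [hv x hx]; exact_mod_cast h)
    refine ⟨y, hy, ?_⟩
    by_cases e : x = y
    · exact .inl e
    · rw [hv _ (sub_ne_zero.2 e)] at hxy
      exact .inr (by exact_mod_cast hxy)

section IntValuation

variable {k : Type*} [Field k] {v : k → ℤ}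

theorem int_valuation_one (hmul : ∀ x y, x ≠ 0 → y ≠ 0 → v (x * y) = v x + v y) : v 1 = 0 := by
  have := hmul 1 1 one_ne_zero one_ne_zero
  rw [mul_one] at this
  omega

theorem int_valuation_neg (hmul : ∀ x y, x ≠ 0 → y ≠ 0 → v (x * y) = v x + v y)
    {x : k} (hx : x ≠ 0) : v (-x) = v x := by
  have h1 := hmul (-1) (-1) (by simp) (by simp)
  have h2 := hmul (-1) x (by simp) hx
  rw [neg_one_mul, neg_neg, int_valuation_one hmul] at h1
  rw [neg_one_mul] at h2
  omega

theorem int_valuation_sub (hmul : ∀ x y, x ≠ 0 → y ≠ 0 → v (x * y) = v x + v y)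
    (hadd : ∀ x y, x ≠ 0 → y ≠ 0 → x + y ≠ 0 → min (v x) (v y) ≤ v (x + y))
    {x y : k} (hx : x ≠ 0) (hy : y ≠ 0) (hxy : x - y ≠ 0) : min (v x) (v y) ≤ v (x - y) := by
  rw [← int_valuation_neg hmul hy, sub_eq_add_neg]
  exact hadd x (-y) hx (neg_ne_zero.2 hy) (by rwa [← sub_eq_add_neg])

/-- An Artin-Schreier value of negative valuation has even valuation. -/
theorem not_odd_int_valuation_of_mul_sub_one
    (hmul : ∀ x y, x ≠ 0 → y ≠ 0 → v (x * y) = v x + v y)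
    (hadd : ∀ x y, x ≠ 0 → y ≠ 0 → x + y ≠ 0 → min (v x) (v y) ≤ v (x + y))
    {z c : k} (hc : c ≠ 0) (hneg : v c < 0) (h : z * (z - 1) = c) : ¬ Odd (v c) := by
  rintro ⟨j, hj⟩
  have hz : z ≠ 0 := by rintro rfl; simp at h; exact hc h.symm
  have hz1 : z - 1 ≠ 0 := by intro e; rw [e, mul_zero] at h; exact hc h.symm
  have h1 := int_valuation_one hmul
  have h2 := int_valuation_sub hmul hadd hz one_ne_zero hz1
  have h3 := hadd (z - 1) 1 hz1 one_ne_zero (by simpa using hz)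
  have h4 := hmul z (z - 1) hz hz1
  rw [sub_add_cancel] at h3
  rw [h] at h4
  omega

/-- If `2` has positive valuation, then `1 + π` is not a square. -/
theorem not_isSquare_one_add_uniformizer
    (hmul : ∀ x y, x ≠ 0 → y ≠ 0 → v (x * y) = v x + v y)
    (hadd : ∀ x y, x ≠ 0 → y ≠ 0 → x + y ≠ 0 → min (v x) (v y) ≤ v (x + y))
    (h2 : (2 : k) ≠ 0) (hv2 : 0 < v 2) {w : k} (hw : w ≠ 0) (hvw : v w = 1) (x : k) :
    x ^ 2 ≠ 1 + w := by
  intro h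
  have e : (x - 1) * (x + 1) = w := by linear_combination h
  have ha : x - 1 ≠ 0 := by intro e'; rw [e', zero_mul] at e; exact hw e.symm
  have hb : x + 1 ≠ 0 := by intro e'; rw [e', mul_zero] at e; exact hw e.symm
  have e1 : x - 1 + 2 = x + 1 := by ring
  have e2 : x + 1 - 2 = x - 1 := by ring
  have h3 := hadd (x - 1) 2 ha h2 (by rwa [e1])
  have h4 := int_valuation_sub hmul hadd hb h2 (by rwa [e2])
  have h5 := hmul _ _ ha hb
  rw [e] at h5
  rw [e1] at h3
  rw [e2] at h4
  omega

/-- If `2` is a unit for the valuation and the residue field is finite, then some unit is not a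
square. -/
theorem exists_unit_not_isSquare
    (hmul : ∀ x y, x ≠ 0 → y ≠ 0 → v (x * y) = v x + v y)
    (hadd : ∀ x y, x ≠ 0 → y ≠ 0 → x + y ≠ 0 → min (v x) (v y) ≤ v (x + y))
    (hfin : ∃ S : Finset k, ∀ x, x ≠ 0 → 0 ≤ v x → ∃ y ∈ S, x = y ∨ 0 < v (x - y))
    (h2 : (2 : k) ≠ 0) (hv2 : ¬ 0 < v 2) :
    ∃ u : k, u ≠ 0 ∧ v u = 0 ∧ ∀ x, x ^ 2 ≠ u := by
  by_contra! H
  obtain ⟨S, hS⟩ := hfin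
  let O := {x : k // x ≠ 0 → 0 ≤ v x}
  have hsymm : ∀ x y : k, x = y ∨ 0 < v (x - y) → y = x ∨ 0 < v (y - x) := by
    rintro x y (rfl | h)
    · exact .inl rfl
    · by_cases e : x = y
      · exact .inl e.symm
      · rw [← neg_sub, int_valuation_neg hmul (sub_ne_zero.2 e)]
        exact .inr h
  have htrans : ∀ x y z : k, x = y ∨ 0 < v (x - y) → y = z ∨ 0 < v (y - z) →
      x = z ∨ 0 < v (x - z) := by
    rintro x y z (rfl | h) (rfl | h')
    · exact .inl rfl
    · exact .inr h'
    · exact .inr h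
    · by_cases e : x = z
      · exact .inl e
      by_cases e1 : x = y
      · subst e1; exact .inr h'
      by_cases e2 : y = z
      · subst e2; exact .inr h
      have := hadd (x - y) (y - z) (sub_ne_zero.2 e1) (sub_ne_zero.2 e2)
        (by rw [sub_add_sub_cancel]; exact sub_ne_zero.2 e)
      rw [sub_add_sub_cancel] at this
      exact .inr (by omega)
  let s : Setoid O :=
    { r := fun x y => x.1 = y.1 ∨ 0 < v (x.1 - y.1)
      iseqv := ⟨fun x => .inl rfl, fun {x y} => hsymm x.1 y.1,
        fun {x y z} => htrans x.1 y.1 z.1⟩ }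
  have hfinite : Finite (Quotient s) := by
    choose! f hfS hf using hS
    have hf' : ∀ x : O, ∃ y ∈ insert 0 (S : Set k), x.1 = y ∨ 0 < v (x.1 - y) := by
      intro x
      by_cases hx : x.1 = 0
      · exact ⟨0, by simp, .inl hx⟩
      · exact ⟨f x.1, by simp [hfS x.1 hx (x.2 hx)], hf x.1 hx (x.2 hx)⟩
    choose g hgS hg using hf'
    have : Finite (insert 0 (S : Set k) : Set k) := (S.finite_toSet.insert 0).to_subtype
    refine Finite.of_injective
      (fun q : Quotient s => (⟨g q.out, hgS q.out⟩ : (insert 0 (S : Set k) : Set k))) ?_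
    intro q r hqr
    have e : g q.out = g r.out := congrArg Subtype.val hqr
    rw [← Quotient.out_eq q, ← Quotient.out_eq r]
    refine Quotient.sound (htrans _ _ _ (hg q.out) (hsymm _ _ ?_))
    rw [e]
    exact hg r.out
  let sqr : O → O := fun x => ⟨x.1 ^ 2, fun h => by
    have hx : x.1 ≠ 0 := fun e => h (by simp [e])
    have := hmul _ _ hx hx
    have h' := x.2 hx
    rw [pow_two]
    omega⟩
  have hsqr : ∀ x y : O, s x y → s (sqr x) (sqr y) := by
    rintro x y (h | h)
    · exact .inl (by simp [sqr, h])
    · by_cases e : x.1 ^ 2 = y.1 ^ 2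
      · exact .inl e
      right
      have e' : (x.1 - y.1) * (x.1 + y.1) = x.1 ^ 2 - y.1 ^ 2 := by ring
      have hne := sub_ne_zero.2 e
      rw [← e'] at hne
      have ha := left_ne_zero_of_mul hne
      have hb := right_ne_zero_of_mul hne
      change 0 < v (x.1 ^ 2 - y.1 ^ 2)
      rw [← e', hmul _ _ ha hb]
      have : 0 ≤ v (x.1 + y.1) := by
        by_cases hx : x.1 = 0
        · rw [hx, zero_add] at hb ⊢
          exact y.2 hb
        by_cases hy : y.1 = 0
        · rw [hy, add_zero] at hb ⊢
          exact x.2 hb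
        have := hadd _ _ hx hy hb
        have := x.2 hx
        have := y.2 hy
        omega
      omega
  let F : Quotient s → Quotient s := Quotient.map sqr hsqr
  have hsurj : Function.Surjective F := by
    intro q
    induction q using Quotient.inductionOn with | _ x =>
    by_cases hx : x.1 ≠ 0 ∧ v x.1 = 0
    · obtain ⟨y, hy⟩ := H x.1 hx.1 hx.2
      have hy0 : y ≠ 0 := by rintro rfl; exact hx.1 (by simpa using hy.symm)
      refine ⟨Quotient.mk s ⟨y, fun _ => ?_⟩, Quotient.sound (.inl hy)⟩
      have := hmul y y hy0 hy0
      rw [← pow_two, hy] at this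
      omega
    · refine ⟨Quotient.mk s ⟨0, fun h => absurd rfl h⟩, Quotient.sound (hsymm _ _ ?_)⟩
      by_cases hx0 : x.1 = 0
      · exact .inl (by simp [sqr, hx0])
      · have := x.2 hx0
        have : v x.1 ≠ 0 := fun h => hx ⟨hx0, h⟩
        refine .inr ?_
        simp only [sqr]
        rw [zero_pow two_ne_zero, sub_zero]
        omega
  have hinj := Finite.injective_iff_surjective.2 hsurj
  have h1 := int_valuation_one hmul
  have hm1 : v (-1) = 0 := by rw [int_valuation_neg hmul one_ne_zero, h1]
  have key := @hinj (Quotient.mk s ⟨1, fun _ => h1.ge⟩) (Quotient.mk s ⟨-1, fun _ => hm1.ge⟩)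
    (Quotient.sound (.inl (by simp [sqr])))
  have e2 : (1 : k) - -1 = 2 := by ring
  rcases Quotient.exact key with h | h
  · have h : (1 : k) = -1 := h
    exact h2 (by linear_combination h)
  · have h : 0 < v ((1 : k) - -1) := h
    rw [e2] at h
    exact hv2 h

end IntValuation

section Quadratic

variable {k K : Type*} [Field k] [Field K] [Algebra k K]

/-- In a separably closed field, a separable quadratic polynomial without roots in the base field
has a root, and it generates an extension of degree two. -/
theorem exists_root_finrank_adjoin_eq_two [IsSepClosed K] {b c : k} (hD : b ^ 2 + 4 * c ≠ 0)
    (hroot : ∀ z : k, z ^ 2 ≠ b * z + c) :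
    ∃ x : K, x ^ 2 = algebraMap k K b * x + algebraMap k K c ∧
      Module.finrank k k⟮x⟯ = 2 := by
  let P : k[X] := X ^ 2 - C b * X - C c
  have hdeg : P.natDegree = 2 := by simp only [P]; compute_degree!
  have hmonic : P.Monic := by
    refine monic_of_natDegree_le_of_coeff_eq_one 2 hdeg.le ?_
    simp [P]
  have hsep : P.Separable := by
    refine ⟨-(C (4 * (b ^ 2 + 4 * c)⁻¹)), C ((b ^ 2 + 4 * c)⁻¹) * (2 * X - C b), ?_⟩
    have hder : derivative P = 2 * X - C b := by
      simp [P, one_add_one_eq_two, show (C 2 : k[X]) = 2 from rfl]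
    have h1 : C ((b ^ 2 + 4 * c)⁻¹) * (C b ^ 2 + 4 * C c) = (1 : k[X]) := by
      have h4 : (4 : k[X]) = C 4 := rfl
      rw [h4, ← C_pow, ← C_mul, ← C_add, ← C_mul, inv_mul_cancel₀ hD, C_1]
    have h4 : C (4 * (b ^ 2 + 4 * c)⁻¹) = (4 : k[X]) * C ((b ^ 2 + 4 * c)⁻¹) := by
      rw [C_mul]; rfl
    rw [hder, h4]
    simp only [P]
    linear_combination h1
  have hirr : Irreducible P := by
    rw [hmonic.irreducible_iff_roots_eq_zero_of_degree_le_three hdeg.ge (by omega)]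
    rw [Multiset.eq_zero_iff_forall_notMem]
    intro z hz
    have := (mem_roots'.1 hz).2
    simp only [P, IsRoot.def, eval_sub, eval_pow, eval_X, eval_mul, eval_C] at this
    exact hroot z (by linear_combination this)
  obtain ⟨x, hx⟩ := IsSepClosed.exists_aeval_eq_zero K P
    (by rw [degree_eq_natDegree hmonic.ne_zero, hdeg]; decide) hsep
  refine ⟨x, ?_, ?_⟩
  · simp only [P, map_sub, map_mul, map_pow, aeval_X, aeval_C] at hx
    linear_combination hx
  · rw [adjoin.finrank ⟨P, hmonic, hx⟩, ← minpoly.eq_of_irreducible_of_monic hirr hx hmonic, hdeg]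

/-- Comparison of two generators of the same quadratic extension having the same trace. -/
theorem exists_of_mem_adjoin_of_finrank_eq_two {b c d : k} {x y : K}
    (hx : x ^ 2 = algebraMap k K b * x + algebraMap k K c)
    (hy : y ^ 2 = algebraMap k K b * y + algebraMap k K d)
    (hx2 : Module.finrank k k⟮x⟯ = 2) (hy2 : Module.finrank k k⟮y⟯ = 2) (hyx : y ∈ k⟮x⟯) :
    ∃ s t : k, t ≠ 0 ∧ 2 * s + t * b = b ∧ s ^ 2 + t ^ 2 * c = b * s + d := by
  have hnot : ∀ z : K, Module.finrank k k⟮z⟯ = 2 → ∀ r : k, algebraMap k K r ≠ z := by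
    rintro z hz r rfl
    rw [adjoin_simple_eq_bot_iff.2 (IntermediateField.algebraMap_mem _ r), IntermediateField.finrank_bot] at hz
    omega
  have hxint : IsIntegral k x := by
    have : FiniteDimensional k k⟮x⟯ := Module.finite_of_finrank_pos (by omega)
    have := IsIntegral.of_finite k (AdjoinSimple.gen k x)
    exact (AdjoinSimple.isIntegral_gen k x).1 this
  obtain ⟨f, hf, hyf⟩ := (adjoin.powerBasis hxint).exists_eq_aeval (⟨y, hyx⟩ : k⟮x⟯)
  rw [adjoin.powerBasis_dim, ← adjoin.finrank hxint, hx2] at hf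
  have hfe := eq_X_add_C_of_natDegree_le_one (Nat.lt_succ_iff.1 hf)
  have e : y = algebraMap k K (f.coeff 1) * x + algebraMap k K (f.coeff 0) := by
    have := congrArg (algebraMap k⟮x⟯ K) hyf
    rw [← aeval_algebraMap_apply, adjoin.powerBasis_gen, AdjoinSimple.algebraMap_gen, hfe] at this
    simpa using this
  set s := f.coeff 0
  set t := f.coeff 1
  have ht : t ≠ 0 := by
    intro h
    rw [h, map_zero, zero_mul, zero_add] at e
    exact hnot y hy2 s e.symm
  have rel : algebraMap k K (t * (2 * s + t * b - b)) * x =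
      algebraMap k K (b * s + d - s ^ 2 - t ^ 2 * c) := by
    simp only [map_mul, map_sub, map_add, map_pow, map_ofNat]
    rw [e] at hy
    linear_combination hy - (algebraMap k K t) ^ 2 * hx
  have h0 : t * (2 * s + t * b - b) = 0 := by
    by_contra h
    refine hnot x hx2 ((b * s + d - s ^ 2 - t ^ 2 * c) / (t * (2 * s + t * b - b))) ?_
    rw [map_div₀, ← rel, mul_div_cancel_left₀]
    exact (map_ne_zero (algebraMap k K)).2 h
  have h1 : b * s + d - s ^ 2 - t ^ 2 * c = 0 := by
    rw [h0, map_zero, zero_mul] at rel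
    exact (map_eq_zero (algebraMap k K)).1 rel.symm
  refine ⟨s, t, ht, ?_, by linear_combination -h1⟩
  have := (mul_eq_zero.1 h0).resolve_left ht
  linear_combination this

/-- Two separable quadratic polynomials with the same trace and no roots define distinct quadratic
extensions unless they are related by an affine substitution. -/
theorem exists_finrank_eq_two_ne [IsSepClosed K] {b c d : k} (hc : b ^ 2 + 4 * c ≠ 0)
    (hd : b ^ 2 + 4 * d ≠ 0) (hcr : ∀ z : k, z ^ 2 ≠ b * z + c)
    (hdr : ∀ z : k, z ^ 2 ≠ b * z + d)
    (hcd : ∀ s t : k, t ≠ 0 → 2 * s + t * b = b → s ^ 2 + t ^ 2 * c ≠ b * s + d) :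
    ∃ E₁ E₂ : IntermediateField k K,
      Module.finrank k E₁ = 2 ∧ Module.finrank k E₂ = 2 ∧ E₁ ≠ E₂ := by
  obtain ⟨x, hx, hx2⟩ := exists_root_finrank_adjoin_eq_two (K := K) hc hcr
  obtain ⟨y, hy, hy2⟩ := exists_root_finrank_adjoin_eq_two (K := K) hd hdr
  refine ⟨k⟮x⟯, k⟮y⟯, hx2, hy2, fun h => ?_⟩
  obtain ⟨s, t, ht, h1, h2⟩ := exists_of_mem_adjoin_of_finrank_eq_two hx hy hx2 hy2
    (h ▸ mem_adjoin_simple_self k y)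
  exact hcd s t ht h1 h2

/-- A nonarchimedean local field has two distinct separable quadratic extensions. -/
theorem IsNonarchLocalField.exists_quadratic_ne {val : k → WithTop ℝ} {p : ℕ}
    (hk : IsNonarchLocalField val p) [IsSepClosed K] :
    ∃ E₁ E₂ : IntermediateField k K,
      Module.finrank k E₁ = 2 ∧ Module.finrank k E₂ = 2 ∧ E₁ ≠ E₂ := by
  obtain ⟨v, hmul, hadd, hsurj, hfin⟩ := hk.exists_int_valuation
  by_cases h2 : (2 : k) = 0
  · obtain ⟨c, hc, hvc⟩ := hsurj (-1)
    obtain ⟨d, hd, hvd⟩ := hsurj (-3)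
    have h4 : (4 : k) = 0 := by linear_combination 2 * h2
    refine exists_finrank_eq_two_ne (b := 1) (c := c) (d := d) (by simp [h4]) (by simp [h4])
      (fun z hz => ?_) (fun z hz => ?_) (fun s t ht h1 hs => ?_)
    · exact not_odd_int_valuation_of_mul_sub_one hmul hadd hc (by omega)
        (z := z) (by linear_combination hz) (by rw [hvc]; decide)
    · exact not_odd_int_valuation_of_mul_sub_one hmul hadd hd (by omega)
        (z := z) (by linear_combination hz) (by rw [hvd]; decide)
    · have ht1 : t = 1 := by linear_combination h1 - s * h2
      subst ht1
      have hdc : d - c ≠ 0 := by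
        intro h
        rw [sub_eq_zero.1 h] at hvd
        omega
      have e1 := int_valuation_sub hmul hadd hd hc hdc
      have e2 := hadd (d - c) c hdc hc (by simpa using hd)
      rw [sub_add_cancel] at e2
      have e3 : v (d - c) = -3 := by omega
      exact not_odd_int_valuation_of_mul_sub_one hmul hadd hdc (by omega)
        (z := s) (by linear_combination hs) (by rw [e3]; decide)
  · have hu : ∃ u : k, u ≠ 0 ∧ v u = 0 ∧ ∀ x, x ^ 2 ≠ u := by
      by_cases hv2 : 0 < v 2
      · obtain ⟨w, hw, hvw⟩ := hsurj 1
        have hns := not_isSquare_one_add_uniformizer hmul hadd h2 hv2 hw hvw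
        have h1 := int_valuation_one hmul
        have hu0 : 1 + w ≠ 0 := fun e => hns 0 (by rw [e]; ring)
        have e1 := hadd 1 w one_ne_zero hw hu0
        have e2 := int_valuation_sub hmul hadd hu0 hw (by simp)
        rw [add_sub_cancel_right] at e2
        exact ⟨1 + w, hu0, by omega, hns⟩
      · exact exists_unit_not_isSquare hmul hadd hfin h2 hv2
    obtain ⟨u, hu0, hvu, hu⟩ := hu
    obtain ⟨w, hw, hvw⟩ := hsurj 1
    have h4 : (4 : k) ≠ 0 := by
      have : (4 : k) = 2 * 2 := by ring
      rw [this]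
      exact mul_ne_zero h2 h2
    refine exists_finrank_eq_two_ne (b := 0) (c := u) (d := w) (by simp [h4, hu0])
      (by simp [h4, hw]) (fun z hz => hu z (by simpa using hz)) (fun z hz => ?_)
      (fun s t ht h1 hs => ?_)
    · have hz : z * z = w := by linear_combination hz
      have hz0 : z ≠ 0 := by rintro rfl; exact hw (by simpa using hz.symm)
      have := hmul z z hz0 hz0
      rw [hz] at this
      omega
    · have hs0 : s = 0 := by simpa [h2] using h1
      have e : t * t * u = w := by rw [hs0] at hs; linear_combination hs
      have e1 := hmul t t ht ht
      have e2 := hmul (t * t) u (mul_ne_zero ht ht) hu0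
      rw [e] at e2
      omega

theorem inf_eq_bot_of_finrank_eq_two {E F : IntermediateField k K}
    (hE : Module.finrank k E = 2) (h : ¬ E ≤ F) : E ⊓ F = ⊥ := by
  have : FiniteDimensional k E := Module.finite_of_finrank_pos (by omega)
  have hdvd : Module.finrank k ↥(E ⊓ F) ∣ 2 := hE ▸ finrank_dvd_of_le_right inf_le_left
  rcases (Nat.dvd_prime Nat.prime_two).1 hdvd with h1 | h1
  · exact finrank_eq_one_iff.1 h1
  · exact absurd (inf_eq_left.1 (eq_of_le_of_finrank_eq inf_le_left (h1.trans hE.symm))) h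

theorem isGalois_of_finrank_eq_two [Algebra.IsSeparable k K] {E : IntermediateField k K}
    (hE : Module.finrank k E = 2) : IsGalois k E := by
  have : Algebra.IsQuadraticExtension k E := { finrank_eq_two' := hE }
  infer_instance

/-- A finite extension whose degree is not divisible by four cannot contain two distinct separable
quadratic extensions. -/
theorem exists_inf_eq_bot_of_not_four_dvd [Algebra.IsSeparable k K]
    {E₁ E₂ F : IntermediateField k K} [FiniteDimensional k F]
    (h₁ : Module.finrank k E₁ = 2) (h₂ : Module.finrank k E₂ = 2) (hne : E₁ ≠ E₂)
    (hF : ¬ 4 ∣ Module.finrank k F) :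
    ∃ E : IntermediateField k K, Module.finrank k E = 2 ∧ E ⊓ F = ⊥ := by
  by_cases hl₁ : E₁ ≤ F
  · by_cases hl₂ : E₂ ≤ F
    · exfalso
      have : FiniteDimensional k E₁ := Module.finite_of_finrank_pos (by omega)
      have : FiniteDimensional k E₂ := Module.finite_of_finrank_pos (by omega)
      have := isGalois_of_finrank_eq_two h₁
      have hle : ¬ E₁ ≤ E₂ := fun h => hne (eq_of_le_of_finrank_eq h (h₁.trans h₂.symm))
      have hd := LinearDisjoint.of_inf_eq_bot (inf_eq_bot_of_finrank_eq_two h₁ hle)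
      have hdvd := finrank_dvd_of_le_right (sup_le hl₁ hl₂)
      rw [hd.finrank_sup, h₁, h₂] at hdvd
      exact hF hdvd
    · exact ⟨E₂, h₂, inf_eq_bot_of_finrank_eq_two h₂ hl₂⟩
  · exact ⟨E₁, h₁, inf_eq_bot_of_finrank_eq_two h₁ hl₁⟩

theorem RestrictsTo.left_unique {E F : IntermediateField k K}
    {σ σ' : ↥(E ⊔ F) ≃ₐ[k] ↥(E ⊔ F)} {τ : (↥E ≃ₐ[k] ↥E) × (↥F ≃ₐ[k] ↥F)}
    (h : RestrictsTo E F σ τ) (h' : RestrictsTo E F σ' τ) : σ = σ' := by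
  have hext : σ.toAlgHom = σ'.toAlgHom := by
    refine algHom_ext_of_eq_adjoin k (S := E ⊔ F) (s := (E : Set K) ∪ F) rfl ?_
    rintro x (hx | hx)
    · exact Subtype.ext ((h.1 x hx).trans (h'.1 x hx).symm)
    · exact Subtype.ext ((h.2 x hx).trans (h'.2 x hx).symm)
  exact AlgEquiv.ext fun x => DFunLike.congr_fun hext x

theorem RestrictsTo.right_unique {E F : IntermediateField k K}
    {σ : ↥(E ⊔ F) ≃ₐ[k] ↥(E ⊔ F)} {τ τ' : (↥E ≃ₐ[k] ↥E) × (↥F ≃ₐ[k] ↥F)}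
    (h : RestrictsTo E F σ τ) (h' : RestrictsTo E F σ τ') : τ = τ' := by
  refine Prod.ext (AlgEquiv.ext fun x => Subtype.ext ?_) (AlgEquiv.ext fun x => Subtype.ext ?_)
  · exact (h.1 x.1 x.2).symm.trans (h'.1 x.1 x.2)
  · exact (h.2 x.1 x.2).symm.trans (h'.2 x.1 x.2)

/-- An automorphism of a field restricts to a normal intermediate field. -/
theorem exists_algEquiv_restrict {E L : IntermediateField k K} [Normal k E] (hle : E ≤ L)
    (σ : ↥L ≃ₐ[k] ↥L) :
    ∃ τ : ↥E ≃ₐ[k] ↥E, ∀ (x : K) (hx : x ∈ E), (σ ⟨x, hle hx⟩ : K) = τ ⟨x, hx⟩ := by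
  let _ : Algebra E L := (inclusion hle).toAlgebra
  have : IsScalarTower k E L := IsScalarTower.of_algebraMap_eq fun _ => rfl
  refine ⟨σ.restrictNormal E, fun x hx => ?_⟩
  have := AlgEquiv.restrictNormal_commutes σ E ⟨x, hx⟩
  exact (congrArg Subtype.val this).symm

/-- For linearly disjoint finite Galois extensions, restriction identifies the automorphisms of the
composite with pairs of automorphisms. -/
theorem existsUnique_restrictsTo {E F : IntermediateField k K} [FiniteDimensional k E]
    [FiniteDimensional k F] [IsGalois k E] [IsGalois k F] (h : E ⊓ F = ⊥) :
    (∀ σ : ↥(E ⊔ F) ≃ₐ[k] ↥(E ⊔ F),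
        ∃! τ : (↥E ≃ₐ[k] ↥E) × (↥F ≃ₐ[k] ↥F), RestrictsTo E F σ τ) ∧
      (∀ τ : (↥E ≃ₐ[k] ↥E) × (↥F ≃ₐ[k] ↥F),
        ∃! σ : ↥(E ⊔ F) ≃ₐ[k] ↥(E ⊔ F), RestrictsTo E F σ τ) := by
  have hex : ∀ σ : ↥(E ⊔ F) ≃ₐ[k] ↥(E ⊔ F),
      ∃ τ : (↥E ≃ₐ[k] ↥E) × (↥F ≃ₐ[k] ↥F), RestrictsTo E F σ τ := fun σ => by
    obtain ⟨τ₁, h₁⟩ := exists_algEquiv_restrict (le_sup_left : E ≤ E ⊔ F) σ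
    obtain ⟨τ₂, h₂⟩ := exists_algEquiv_restrict (le_sup_right : F ≤ E ⊔ F) σ
    exact ⟨(τ₁, τ₂), h₁, h₂⟩
  choose φ hφ using hex
  have hinj : Function.Injective φ := fun σ σ' e => (hφ σ).left_unique (e ▸ hφ σ')
  have hgal : IsGalois k ↥(E ⊔ F) := { }
  have hcard : Nat.card (↥(E ⊔ F) ≃ₐ[k] ↥(E ⊔ F)) =
      Nat.card ((↥E ≃ₐ[k] ↥E) × (↥F ≃ₐ[k] ↥F)) := by
    rw [Nat.card_prod, IsGalois.card_aut_eq_finrank, IsGalois.card_aut_eq_finrank,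
      IsGalois.card_aut_eq_finrank, (LinearDisjoint.of_inf_eq_bot h).finrank_sup]
  have hbij := (Nat.bijective_iff_injective_and_card φ).2 ⟨hinj, hcard⟩
  refine ⟨fun σ => ⟨φ σ, hφ σ, fun τ hτ => hτ.right_unique (hφ σ)⟩, fun τ => ?_⟩
  obtain ⟨σ, rfl⟩ := hbij.2 τ
  exact ⟨σ, hφ σ, fun σ' hσ' => hσ'.left_unique (hφ σ)⟩

end Quadratic

end LocalFieldQuadratic


/-- **Lemma 2.2(2)**: let `k` be a nonarchimedean local field of residual characteristic `p`,
with separable closure `K`, and let `F ⊆ K` be a finite Galois extension of `k` with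
`Gal(F/k)` isomorphic to the trivial group, `ℤ/2ℤ`, `ℤ/3ℤ` or `S₃`.  Then there is a Galois
extension `E ⊆ K` of `k` of degree `2` with `E ∩ F = k`, and consequently the restriction
map `Gal(EF/k) → Gal(E/k) × Gal(F/k)` is an isomorphism (expressed here by saying that
restriction gives a bijective correspondence between `Gal(EF/k)` and pairs). -/
theorem exists_quadratic_extension_disjoint_from_F
    {k : Type*} [Field k] (p : ℕ) (hp : p.Prime) (val : k → WithTop ℝ)
    (hk : IsNonarchLocalField val p)
    {K : Type*} [Field K] [Algebra k K] [IsSepClosure k K]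
    (F : IntermediateField k K) [FiniteDimensional k ↥F] [IsGalois k ↥F]
    (hgal : Nonempty ((↥F ≃ₐ[k] ↥F) ≃* Multiplicative (ZMod 1)) ∨
            Nonempty ((↥F ≃ₐ[k] ↥F) ≃* Multiplicative (ZMod 2)) ∨
            Nonempty ((↥F ≃ₐ[k] ↥F) ≃* Multiplicative (ZMod 3)) ∨
            Nonempty ((↥F ≃ₐ[k] ↥F) ≃* Equiv.Perm (Fin 3))) :
    ∃ E : IntermediateField k K,
      IsGalois k ↥E ∧ Module.finrank k ↥E = 2 ∧ E ⊓ F = ⊥ ∧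
      (∀ σ : ↥(E ⊔ F) ≃ₐ[k] ↥(E ⊔ F),
        ∃! τ : (↥E ≃ₐ[k] ↥E) × (↥F ≃ₐ[k] ↥F), RestrictsTo E F σ τ) ∧
      (∀ τ : (↥E ≃ₐ[k] ↥E) × (↥F ≃ₐ[k] ↥F),
        ∃! σ : ↥(E ⊔ F) ≃ₐ[k] ↥(E ⊔ F), RestrictsTo E F σ τ) := by
  have : IsSepClosed K := IsSepClosure.sep_closed k
  have : Algebra.IsSeparable k K := IsSepClosure.separable
  have hF : ¬ 4 ∣ Module.finrank k F := by
    rw [← IsGalois.card_aut_eq_finrank]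
    rcases hgal with ⟨⟨e⟩⟩ | ⟨⟨e⟩⟩ | ⟨⟨e⟩⟩ | ⟨⟨e⟩⟩ <;> rw [Nat.card_congr e.toEquiv]
    · rw [Nat.card_congr Multiplicative.toAdd, Nat.card_zmod]; decide
    · rw [Nat.card_congr Multiplicative.toAdd, Nat.card_zmod]; decide
    · rw [Nat.card_congr Multiplicative.toAdd, Nat.card_zmod]; decide
    · rw [Nat.card_perm, Nat.card_fin]; decide
  obtain ⟨E₁, E₂, h₁, h₂, hne⟩ := hk.exists_quadratic_ne (K := K)
  obtain ⟨E, hE, hEF⟩ := exists_inf_eq_bot_of_not_four_dvd h₁ h₂ hne hF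
  have : FiniteDimensional k E := Module.finite_of_finrank_pos (by omega)
  have hgalE := isGalois_of_finrank_eq_two hE
  exact ⟨E, hgalE, hE, hEF, existsUnique_restrictsTo hEF⟩
end

section
/- Let Φ be a finite reduced crystallographic root system with Weyl group W, and let p be a prime not dividing the order |W|. Then for every subset Φ₀ ⊆ Φ that is closed, meaning (ℤ-span of Φ₀) ∩ Φ = Φ₀, the quotient abelian group ℤΦ/ℤΦ₀ has no element of order p, i.e., it is p-torsion free. (Lemma 3.2(1): p is not a bad prime for Φ.) -/
/-- `Φ` is a finite reduced crystallographic root system in the `ℚ`-vector space `V`,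
with coroot map `coroot : Φ → V^*`. -/
structure IsRootSystem {V : Type*} [AddCommGroup V] [Module ℚ V]
    (Φ : Finset V) (coroot : V → Module.Dual ℚ V) : Prop where
  coroot_self : ∀ α ∈ Φ, coroot α α = 2
  crystallographic : ∀ α ∈ Φ, ∀ β ∈ Φ, ∃ n : ℤ, coroot α β = (n : ℚ)
  reflect_mem : ∀ α ∈ Φ, ∀ β ∈ Φ, β - coroot α β • α ∈ Φ
  reduced : ∀ α ∈ Φ, ∀ c : ℚ, c • α ∈ Φ → c = 1 ∨ c = -1

/-- The Weyl group of the root system `Φ`: the subgroup of linear automorphisms of `V`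
generated by the reflections `s_α : v ↦ v - ⟨α̌, v⟩ α` for `α ∈ Φ`. -/
def weylGroup {V : Type*} [AddCommGroup V] [Module ℚ V]
    (Φ : Finset V) (coroot : V → Module.Dual ℚ V) : Subgroup (V ≃ₗ[ℚ] V) :=
  Subgroup.closure { w : V ≃ₗ[ℚ] V | ∃ α ∈ Φ, ∀ v : V, w v = v - coroot α v • α }

/-- The subgroup generated by the reflections in a subset `S` of the roots moves every vector of
the root lattice by an element of `ℤS`. -/
theorem sub_mem_span_of_mem_closure_reflections {V : Type*} [AddCommGroup V] [Module ℚ V]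
    (Φ : Finset V) (coroot : V → Module.Dual ℚ V) (hRS : IsRootSystem Φ coroot)
    (S : Set V) (hS : S ⊆ ↑Φ) (w : V ≃ₗ[ℚ] V)
    (hw : w ∈ Subgroup.closure
      { w : V ≃ₗ[ℚ] V | ∃ α ∈ S, ∀ v : V, w v = v - coroot α v • α })
    (x : V) (hx : x ∈ Submodule.span ℤ (↑Φ : Set V)) :
    w x - x ∈ Submodule.span ℤ S := by
  have hSΦ : Submodule.span ℤ S ≤ Submodule.span ℤ (↑Φ : Set V) := Submodule.span_mono hS
  have coroot_int : ∀ α ∈ Φ, ∀ v ∈ Submodule.span ℤ (↑Φ : Set V),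
      ∃ n : ℤ, coroot α v = n := by
    intro α hα v hv
    induction hv using Submodule.span_induction with
    | mem β hβ => exact hRS.crystallographic α hα β hβ
    | zero => exact ⟨0, by simp⟩
    | add a b _ _ ha hb =>
      obtain ⟨m, hm⟩ := ha
      obtain ⟨n, hn⟩ := hb
      exact ⟨m + n, by simp [hm, hn]⟩
    | smul c a _ ha =>
      obtain ⟨m, hm⟩ := ha
      exact ⟨c * m, by simp [hm]⟩
  have reflection_sub : ∀ s : V ≃ₗ[ℚ] V, (∃ α ∈ S, ∀ v : V, s v = v - coroot α v • α) →
      ∀ v ∈ Submodule.span ℤ (↑Φ : Set V), s v - v ∈ Submodule.span ℤ S := by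
    rintro s ⟨α, hα, hs⟩ v hv
    obtain ⟨n, hn⟩ := coroot_int α (hS hα) v hv
    rw [hs, hn, sub_sub_cancel_left, Int.cast_smul_eq_zsmul]
    exact neg_mem (Submodule.smul_mem _ _ (Submodule.subset_span hα))
  induction hw using Subgroup.closure_induction_left generalizing x with
  | one => simp
  | mul_left s hs w _ ih =>
    have hwx : w x ∈ Submodule.span ℤ (↑Φ : Set V) := by
      simpa using add_mem (hSΦ (ih x hx)) hx
    simpa using add_mem (reflection_sub s hs _ hwx) (ih x hx)
  | inv_mul_cancel s hs w _ ih =>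
    have hinv : s⁻¹ = s := by
      obtain ⟨α, hα, h⟩ := hs
      refine inv_eq_of_mul_eq_one_left ?_
      ext v
      simp only [LinearEquiv.mul_apply, h, map_sub, map_smul, smul_eq_mul,
        hRS.coroot_self α (hS hα), LinearEquiv.coe_one, id_eq]
      module
    have hwx : w x ∈ Submodule.span ℤ (↑Φ : Set V) := by
      simpa using add_mem (hSΦ (ih x hx)) hx
    rw [hinv]
    simpa using add_mem (reflection_sub s hs _ hwx) (ih x hx)

/-- The sum over a finite group containing a reflection `s` with `s α = -α` annihilates `α`. -/
theorem sum_apply_eq_zero_of_apply_eq_neg {V : Type*} [AddCommGroup V] [Module ℚ V]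
    (G : Subgroup (V ≃ₗ[ℚ] V)) [Fintype G] (s : G) (α : V)
    (hs : (s : V ≃ₗ[ℚ] V) α = -α) : ∑ w : G, (w : V ≃ₗ[ℚ] V) α = 0 := by
  have h : ∑ w : G, (w : V ≃ₗ[ℚ] V) α = -∑ w : G, (w : V ≃ₗ[ℚ] V) α := by
    conv_lhs => rw [← Equiv.sum_comp (Equiv.mulRight s)]
    simp [LinearEquiv.mul_apply, hs]
  have h2 : (2 : ℚ) • ∑ w : G, (w : V ≃ₗ[ℚ] V) α = 0 := by
    rw [two_smul]
    exact eq_neg_iff_add_eq_zero.mp h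
  exact (smul_eq_zero.mp h2).resolve_left two_ne_zero

/-- **Lemma 3.2(1)**: if `p` is a prime not dividing the order of the Weyl group of a finite
reduced crystallographic root system `Φ`, then for every closed subset `Φ₀ ⊆ Φ`
(i.e. `ℤΦ₀ ∩ Φ = Φ₀`) the quotient `ℤΦ/ℤΦ₀` is `p`-torsion free; that is, `p` is not a
bad prime for `Φ`. -/
theorem zspan_quotient_p_torsion_free
    {V : Type*} [AddCommGroup V] [Module ℚ V] [FiniteDimensional ℚ V]
    (Φ : Finset V) (coroot : V → Module.Dual ℚ V)
    (hRS : IsRootSystem Φ coroot)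
    (p : ℕ) (hp : p.Prime) (hpW : ¬ p ∣ Nat.card (weylGroup Φ coroot))
    (Φ₀ : Set V) (hΦ₀ : Φ₀ ⊆ ↑Φ)
    (hclosed : (Submodule.span ℤ Φ₀ : Set V) ∩ ↑Φ = Φ₀) :
    ∀ x ∈ Submodule.span ℤ (↑Φ : Set V),
      (p : ℤ) • x ∈ Submodule.span ℤ Φ₀ → x ∈ Submodule.span ℤ Φ₀ := by
  intro x hx hpx
  let R : Set (V ≃ₗ[ℚ] V) := { w | ∃ α ∈ Φ₀, ∀ v : V, w v = v - coroot α v • α }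
  let G : Subgroup (V ≃ₗ[ℚ] V) := Subgroup.closure R
  have hGW : G ≤ weylGroup Φ coroot :=
    Subgroup.closure_mono fun _ ⟨α, hα, h⟩ ↦ ⟨α, hΦ₀ hα, h⟩
  have hpG : ¬ p ∣ Nat.card G := fun h ↦ hpW (h.trans (Subgroup.card_dvd_of_le hGW))
  have : Finite G := Nat.finite_of_card_ne_zero fun h ↦ hpG (h ▸ dvd_zero p)
  have : Fintype G := Fintype.ofFinite G
  have sum_span : ∀ v ∈ Submodule.span ℤ Φ₀, ∑ w : G, (w : V ≃ₗ[ℚ] V) v = 0 := by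
    intro v hv
    induction hv using Submodule.span_induction with
    | mem α hα =>
      have hα2 := hRS.coroot_self α (hΦ₀ hα)
      refine sum_apply_eq_zero_of_apply_eq_neg G
        ⟨Module.reflection hα2, Subgroup.subset_closure ⟨α, hα, fun v ↦ ?_⟩⟩ α ?_
      · exact Module.reflection_apply v hα2
      · exact Module.reflection_apply_self hα2
    | zero => simp
    | add a b _ _ ha hb => simp [Finset.sum_add_distrib, ha, hb]
    | smul c a _ ha => simp [← Finset.smul_sum, ha]
  have sum_x : ∑ w : G, (w : V ≃ₗ[ℚ] V) x = 0 := by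
    have h : (p : ℚ) • ∑ w : G, (w : V ≃ₗ[ℚ] V) x = 0 := by
      simpa [Finset.smul_sum, Nat.cast_smul_eq_nsmul] using sum_span _ hpx
    exact (smul_eq_zero.mp h).resolve_left (Nat.cast_ne_zero.mpr hp.ne_zero)
  have card_smul : (Nat.card G : ℤ) • x ∈ Submodule.span ℤ Φ₀ := by
    have h : ∑ w : G, ((w : V ≃ₗ[ℚ] V) x - x) ∈ Submodule.span ℤ Φ₀ :=
      sum_mem fun w _ ↦
        sub_mem_span_of_mem_closure_reflections Φ coroot hRS Φ₀ hΦ₀ w w.2 x hx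
    rw [Finset.sum_sub_distrib, sum_x, zero_sub] at h
    simpa using neg_mem h
  obtain ⟨a, b, hab⟩ :=
    Nat.isCoprime_iff_coprime.mpr ((Nat.Prime.coprime_iff_not_dvd hp).mpr hpG)
  rw [← one_smul ℤ x, ← hab, add_smul, mul_smul, mul_smul]
  exact add_mem (Submodule.smul_mem _ a hpx) (Submodule.smul_mem _ b card_smul)
end
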